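/- arXiv:2107.02617 — 4 statements merged into one kernel-verified Lean document; each statement's English description precedes it below -/
import Mathlib

section
/- In the Dove-to-DLog reduction, every value of the indexing function lies in the image of C: for every x ∈ [2^n] there exists r ∈ {0,1}^n such that I(x) = C(r). -/
/-- The all-zero bitstring `0^n`. -/
def zeroS (n : ℕ) : Fin n → Bool := fun _ => false

/-- The bitstring `0^{n-1}1` with a single 1 in the last position. -/
def oneS (n : ℕ) : Fin n → Bool := fun i => decide ((i : ℕ) = n - 1)

/-- Bitwise XOR of bitstrings. -/
def bxor {n : ℕ} (u v : Fin n → Bool) : Fin n → Bool := fun i => xor (u i) (v i)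

/-- The groupoid operation of the Dove-to-DLog reduction. -/
def fDove (n : ℕ) (C : (Fin n → Bool) → Fin n → Bool) (x y : Fin n → Bool) :
    Fin n → Bool :=
  if x = y then C x
  else if x = zeroS n ∧ y ≠ zeroS n then C (bxor y (oneS n))
  else bxor x y

/-- Square-and-multiply over the binary digits of `x` (most significant bit first,
with the single digit 0 for `x = 0`), starting from `e`. -/
def sqmul {α : Type*} (sq : α → α) (mul : α → α) (e : α) (x : ℕ) : α :=
  (if x = 0 then [false] else x.bits.reverse).foldl
    (fun r b => if b then mul (sq r) else sq r) e

/-- The indexing function of the Dove-to-DLog reduction: square-and-multiply with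
identity string `0^{n-1}1` and generator string `0^n`. -/
def IdxD (n : ℕ) (C : (Fin n → Bool) → Fin n → Bool) (x : ℕ) : Fin n → Bool :=
  sqmul (fun r => fDove n C r r) (fun r => fDove n C (zeroS n) r) (oneS n) x

theorem fDove_self_mem_range (n : ℕ) (C : (Fin n → Bool) → Fin n → Bool) (r : Fin n → Bool) :
    ∃ s, fDove n C r r = C s :=
  ⟨r, by simp [fDove]⟩

theorem fDove_zeroS_mem_range (n : ℕ) (C : (Fin n → Bool) → Fin n → Bool) (r : Fin n → Bool) :
    ∃ s, fDove n C (zeroS n) r = C s := by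
  by_cases h : zeroS n = r
  · exact ⟨zeroS n, by simp [fDove, h]⟩
  · exact ⟨bxor r (oneS n), by simp [fDove, h, Ne.symm h]⟩

/-- The value of square-and-multiply is produced by a squaring or a multiplication,
since at least one digit is processed. -/
theorem sqmul_induction {α : Type*} {sq mul : α → α} {P : α → Prop}
    (hsq : ∀ r, P (sq r)) (hmul : ∀ r, P (mul r)) (e : α) (x : ℕ) :
    P (sqmul sq mul e x) := by
  have foldl_concat : ∀ (l : List Bool) (b : Bool),
      P ((l ++ [b]).foldl (fun r b => if b then mul (sq r) else sq r) e) := by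
    intro l b
    cases b <;> simp [hsq, hmul]
  unfold sqmul
  split_ifs with hx
  · exact foldl_concat [] false
  · cases hl : x.bits with
    | nil =>
      refine absurd ?_ hx
      rw [← Nat.size_eq_zero, ← Nat.size_eq_bits_len, hl, List.length_nil]
    | cons b l => rw [List.reverse_cons]; exact foldl_concat _ _

theorem dove_dlog_index_in_image_of_C (n : ℕ) (hn : 1 ≤ n)
    (C : (Fin n → Bool) → Fin n → Bool) :
    ∀ x < 2^n, ∃ r : Fin n → Bool, IdxD n C x = C r := by
  intro x _
  exact sqmul_induction (P := fun s => ∃ r, s = C r)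
    (fDove_self_mem_range n C) (fDove_zeroS_mem_range n C) (oneS n) x
end

section
/- Correctness of the reduction from General-Claw to Collision: Let n ≥ 1, let g₀, g₁ : {0,1}^n → {0,1}^n be any functions, and let s be an integer with 1 ≤ s < 2^n. Define C : {0,1}^{n+1} → {0,1}^n by C(x₀x₁…x_n) = g_{x₀}(g_{x₁}(⋯ g_{x_n}(0^n)⋯)), i.e., starting from 0^n, apply g_{x_n}, then g_{x_{n−1}}, …, finally g_{x₀}. If x ≠ y ∈ {0,1}^{n+1} and C(x) = C(y), then at least one of the following holds: (1) ∃ u, v with val u < s, val v < s and g₀(u) = g₁(v); (2) ∃ distinct u, v with g₀(u) = g₀(v); (3) ∃ distinct u, v with g₁(u) = g₁(v); (4) ∃ u with val u < s and val(g₀(u)) ≥ s; (5) ∃ u with val u < s and val(g₁(u)) ≥ s. -/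
/-- The number whose binary expansion (most significant bit first) is `u`. -/
def valS {n : ℕ} (u : Fin n → Bool) : ℕ :=
  (List.ofFn u).foldl (fun a b => 2*a + (if b then 1 else 0)) 0

/-- Apply the chain of functions selected by the list of bits: the head of the list
selects the outermost (last applied) function. -/
def applyChain (n : ℕ) (g₀ g₁ : (Fin n → Bool) → Fin n → Bool) :
    List Bool → Fin n → Bool
  | [] => fun _ => false
  | b :: rest => (if b then g₁ else g₀) (applyChain n g₀ g₁ rest)

/-- The Collision instance built from a General-Claw instance `(g₀, g₁, s)`:
`C(x₀x₁…x_n) = g_{x₀}(g_{x₁}(⋯ g_{x_n}(0^n)⋯))`. -/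
def Cgc (n : ℕ) (g₀ g₁ : (Fin n → Bool) → Fin n → Bool) (x : Fin (n+1) → Bool) :
    Fin n → Bool :=
  applyChain n g₀ g₁ (List.ofFn x)

theorem valS_zero (n : ℕ) : valS (fun _ : Fin n => false) = 0 := by
  have h : ∀ k : ℕ, (List.replicate k false).foldl
      (fun a b => 2 * a + (if b then 1 else 0)) 0 = 0 := by
    intro k
    induction k with
    | zero => rfl
    | succ k ih => simpa [List.replicate_succ] using ih
  simpa [valS, List.ofFn_const] using h n

/-- If both functions preserve the set of strings of value below `s`, so does every chain. -/
theorem valS_applyChain_lt {n s : ℕ} {g₀ g₁ : (Fin n → Bool) → Fin n → Bool} (hs : 1 ≤ s)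
    (h₀ : ∀ u, valS u < s → valS (g₀ u) < s) (h₁ : ∀ u, valS u < s → valS (g₁ u) < s)
    (l : List Bool) : valS (applyChain n g₀ g₁ l) < s := by
  induction l with
  | nil => simpa [applyChain, valS_zero] using Nat.lt_of_succ_le hs
  | cons b l ih =>
    cases b
    · simpa [applyChain] using h₀ _ ih
    · simpa [applyChain] using h₁ _ ih

/-- For injective, claw-free functions preserving the strings of value below `s`, the chain
determines the selecting bits among lists of a given length. -/
theorem applyChain_injective_of_length_eq {n s : ℕ} {g₀ g₁ : (Fin n → Bool) → Fin n → Bool}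
    (hs : 1 ≤ s)
    (h₀ : ∀ u, valS u < s → valS (g₀ u) < s) (h₁ : ∀ u, valS u < s → valS (g₁ u) < s)
    (i₀ : Function.Injective g₀) (i₁ : Function.Injective g₁)
    (hclaw : ∀ u v, valS u < s → valS v < s → g₀ u ≠ g₁ v) {l m : List Bool}
    (hlen : l.length = m.length) (h : applyChain n g₀ g₁ l = applyChain n g₀ g₁ m) :
    l = m := by
  induction l generalizing m with
  | nil => exact (List.length_eq_zero_iff.mp hlen.symm).symm
  | cons b l ih =>
    cases m with
    | nil => simp at hlen
    | cons c m =>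
      have hlen' : l.length = m.length := by simpa using hlen
      have hl := valS_applyChain_lt hs h₀ h₁ l
      have hm := valS_applyChain_lt hs h₀ h₁ m
      cases b <;> cases c <;> simp only [applyChain, if_true, Bool.false_eq_true, if_false] at h
      · rw [ih hlen' (i₀ h)]
      · exact absurd h (hclaw _ _ hl hm)
      · exact absurd h.symm (hclaw _ _ hm hl)
      · rw [ih hlen' (i₁ h)]

theorem generalclaw_to_collision (n : ℕ) (hn : 1 ≤ n)
    (g₀ g₁ : (Fin n → Bool) → Fin n → Bool)
    (s : ℕ) (hs1 : 1 ≤ s) (hs2 : s < 2^n)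
    (x y : Fin (n+1) → Bool) (hxy : x ≠ y) (hC : Cgc n g₀ g₁ x = Cgc n g₀ g₁ y) :
    (∃ u v : Fin n → Bool, valS u < s ∧ valS v < s ∧ g₀ u = g₁ v) ∨
    (∃ u v : Fin n → Bool, u ≠ v ∧ g₀ u = g₀ v) ∨
    (∃ u v : Fin n → Bool, u ≠ v ∧ g₁ u = g₁ v) ∨
    (∃ u : Fin n → Bool, valS u < s ∧ s ≤ valS (g₀ u)) ∨
    (∃ u : Fin n → Bool, valS u < s ∧ s ≤ valS (g₁ u)) := by
  by_contra! hcon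
  obtain ⟨hclaw, i₀, i₁, h₀, h₁⟩ := hcon
  refine hxy (List.ofFn_injective
    (applyChain_injective_of_length_eq hs1 h₀ h₁ ?_ ?_ hclaw (by simp) hC))
  · exact fun u v h => by_contra fun huv => i₀ u v huv h
  · exact fun u v h => by_contra fun huv => i₁ u v huv h
end

section
/- Shifted-identity lemma for square-and-multiply: let n ≥ 1 and w ∈ [2^n]. Define I_w : [2^n] → ℕ by: on input x, let b_m,…,b_1 be the binary digits of x from most significant to least significant (for x = 0 take the single digit 0); set r := w; for i = m down to 1: replace r by (2·((r + 2^n − w) mod 2^n) + w) mod 2^n (the 'square' step), and if b_i = 1 then additionally replace r by (r + 1) mod 2^n (the 'multiply' step); I_w(x) is the final r. Then I_w(x) = (x + w) mod 2^n for every x ∈ [2^n]. -/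
/-- The shifted-identity indexing function: square step `r ↦ 2·(r − w) + w (mod 2^n)`,
multiply step `r ↦ r + 1 (mod 2^n)`, identity `w`. -/
def Iw (n w : ℕ) (x : ℕ) : ℕ :=
  sqmul (fun r => (2 * ((r + 2^n - w) % 2^n) + w) % 2^n)
    (fun r => (r + 1) % 2^n) w x

theorem add_mod_add_sub_mod {N w : ℕ} (hw : w < N) (y : ℕ) :
    ((y + w) % N + N - w) % N = y % N := by
  have h : (y + w) % N + N - w + N * ((y + w) / N) = y + N := by
    have := Nat.mod_add_div (y + w) N
    omega
  rw [← Nat.add_mul_mod_self_left _ N ((y + w) / N), h, Nat.add_mod_right]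

theorem shifted_double_mod {N w : ℕ} (hw : w < N) (y : ℕ) :
    (2 * (((y + w) % N + N - w) % N) + w) % N = (2 * y + w) % N := by
  rw [add_mod_add_sub_mod hw]
  exact ((Nat.mod_modEq y N).mul_left 2).add_right w

theorem foldl_bits_reverse_shifted {N w : ℕ} (hw : w < N) (x : ℕ) :
    x.bits.reverse.foldl
      (fun r b => if b then ((2 * ((r + N - w) % N) + w) % N + 1) % N
        else (2 * ((r + N - w) % N) + w) % N) w = (x + w) % N := by
  induction x using Nat.binaryRec' with
  | zero => simp [Nat.mod_eq_of_lt hw]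
  | bit b x hb ih =>
    rw [Nat.bits_append_bit x b hb, List.reverse_cons, List.foldl_append, ih]
    simp only [List.foldl_cons, List.foldl_nil, shifted_double_mod hw]
    cases b
    · simp [Nat.bit_val]
    · simp [Nat.bit_val, Nat.add_right_comm]

theorem shifted_identity_sqmul (n : ℕ) (hn : 1 ≤ n) (w : ℕ) (hw : w < 2^n) :
    ∀ x < 2^n, Iw n w x = (x + w) % 2^n := by
  intro x _
  unfold Iw sqmul
  split_ifs with hx
  · simp [hx]
  · exact foldl_bits_reverse_shifted hw x
end

section
/- Correctness of the reduction from Pigeon to Blichfeldt: let n ≥ 1 and C : {0,1}^n → {0,1}^n with C(0^n) ≠ 0^n. Define V : {0,1}^n → {0,1}^n by V(x) = C(x) if C(x) ≠ 0^n, and V(x) = C(0^n) otherwise, and let e : {0,1}^n → (Fin n → ℤ) send a bitstring to its 0/1 integer vector. Then: (i) for every x, not every coordinate of e(V(x)) is even (i.e., e(V(x)) does not lie in the lattice 2ℤ^n); (ii) for all x, y, if every coordinate of e(V(x)) − e(V(y)) is even, then V(x) = V(y); (iii) if u ≠ v and V(u) = V(v), then either there exists w with C(w) = 0^n, or there exist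 distinct a, b with C(a) = C(b). -/
/-- The 0/1 integer vector of a bitstring. -/
def eInt (n : ℕ) (u : Fin n → Bool) : Fin n → ℤ := fun i => if u i then 1 else 0

/-- The Blichfeldt instance circuit built from a Pigeon instance `C`. -/
def Vbl (n : ℕ) (C : (Fin n → Bool) → Fin n → Bool) (x : Fin n → Bool) :
    Fin n → Bool :=
  if C x ≠ (fun _ => false) then C x else C (fun _ => false)

theorem eq_of_two_dvd_eInt_sub {n : ℕ} {u v : Fin n → Bool}
    (h : ∀ i, (2 : ℤ) ∣ eInt n u i - eInt n v i) : u = v := by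
  funext i
  have hi := h i
  unfold eInt at hi
  cases hu : u i <;> cases hv : v i <;> simp [hu, hv] at hi ⊢

theorem Vbl_ne_zero {n : ℕ} {C : (Fin n → Bool) → Fin n → Bool}
    (hC : C (fun _ => false) ≠ fun _ => false) (x : Fin n → Bool) :
    Vbl n C x ≠ fun _ => false := by
  unfold Vbl
  split_ifs with h
  · exact h
  · exact hC

theorem pigeon_to_blichfeldt (n : ℕ) (hn : 1 ≤ n)
    (C : (Fin n → Bool) → Fin n → Bool)
    (hC : C (fun _ => false) ≠ fun _ => false) :
    (∀ x : Fin n → Bool, ¬ ∀ i : Fin n, (2 : ℤ) ∣ eInt n (Vbl n C x) i) ∧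
    (∀ x y : Fin n → Bool,
      (∀ i : Fin n, (2 : ℤ) ∣ (eInt n (Vbl n C x) i - eInt n (Vbl n C y) i)) →
      Vbl n C x = Vbl n C y) ∧
    (∀ u v : Fin n → Bool, u ≠ v → Vbl n C u = Vbl n C v →
      (∃ w : Fin n → Bool, C w = fun _ => false) ∨
      (∃ a b : Fin n → Bool, a ≠ b ∧ C a = C b)) := by
  refine ⟨fun x h => Vbl_ne_zero hC x (eq_of_two_dvd_eInt_sub fun i => ?_),
    fun x y h => eq_of_two_dvd_eInt_sub h, fun u v huv h => ?_⟩
  · simpa [eInt] using h i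
  · by_cases hw : ∃ w, C w = fun _ => false
    · exact Or.inl hw
    · push Not at hw
      exact Or.inr ⟨u, v, huv, by simpa only [Vbl, if_pos (hw u), if_pos (hw v)] using h⟩
end
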